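/- arXiv:1205.6671 — 2 statements merged into one kernel-verified Lean document; each statement's English description precedes it below -/
import Mathlib

section
/- Let H be a Pommaret basis of the proper nonzero homogeneous ideal I of P for some term order, and let D be the Krull dimension of P/I. Then lt(I) ∩ k[x_1,…,x_D] = {0}, and the restriction of the canonical map P → P/I to the subring k[x_1,…,x_D] is injective and makes P/I a finitely generated k[x_1,…,x_D]-module (i.e., it defines a Noether normalisation of P/I). -/
open MvPolynomial

/-- The (0-based) class of a nonzero exponent vector: the smallest index with
nonzero entry.  (The variables `x_1, …, x_n` of the paper are `X 0, …, X (n-1)`.) -/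
noncomputable def cls {n : ℕ} (μ : Fin n →₀ ℕ) : ℕ :=
  sInf {i : ℕ | ∃ hi : i < n, μ ⟨i, hi⟩ ≠ 0}

/-- `x^μ` involutively divides `x^ν` : it divides it and the quotient only involves
the multiplicative variables `x_1, …, x_{cls μ}` of `x^μ`. -/
def InvDiv {n : ℕ} (μ ν : Fin n →₀ ℕ) : Prop :=
  μ ≤ ν ∧ ∀ j : Fin n, ν j ≠ μ j → (j : ℕ) ≤ cls μ

/-- The exponent of the leading term of `f` with respect to the monomial order `m`. -/
noncomputable def ldeg {n : ℕ} {K : Type*} [Field K] (m : MonomialOrder (Fin n))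
    (f : MvPolynomial (Fin n) K) : Fin n →₀ ℕ :=
  m.toSyn.symm (f.support.sup fun μ => m.toSyn μ)

/-- The leading ideal `lt(I)` of an ideal `I` with respect to `m`. -/
noncomputable def ltIdeal {n : ℕ} {K : Type*} [Field K] (m : MonomialOrder (Fin n))
    (I : Ideal (MvPolynomial (Fin n) K)) : Ideal (MvPolynomial (Fin n) K) :=
  Ideal.span {g | ∃ f ∈ I, f ≠ 0 ∧ g = monomial (ldeg m f) (1 : K)}

/-- `H` is a (finite, monomial) Pommaret basis of the monomial ideal `I`:
it generates `I` and every monomial of `I` has a unique involutive divisor in `H`. -/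
def IsMonPB {n : ℕ} {K : Type*} [Field K] (H : Set (Fin n →₀ ℕ))
    (I : Ideal (MvPolynomial (Fin n) K)) : Prop :=
  H.Finite ∧ I = Ideal.span ((fun μ => monomial μ (1 : K)) '' H) ∧
    ∀ ν : Fin n →₀ ℕ, monomial ν (1 : K) ∈ I → ∃! μ, μ ∈ H ∧ InvDiv μ ν

/-- `H` is a Pommaret basis of the polynomial ideal `I` w.r.t. the monomial order `m`:
its elements lie in `I`, are nonzero with pairwise distinct leading terms, and the
leading terms form a Pommaret basis of the leading ideal. -/
def IsPB {n : ℕ} {K : Type*} [Field K] (m : MonomialOrder (Fin n))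
    (H : Finset (MvPolynomial (Fin n) K)) (I : Ideal (MvPolynomial (Fin n) K)) : Prop :=
  (∀ h ∈ H, h ∈ I) ∧ (∀ h ∈ H, h ≠ 0) ∧
    Set.InjOn (fun h : MvPolynomial (Fin n) K => ldeg m h) ↑H ∧
    IsMonPB ((fun h : MvPolynomial (Fin n) K => ldeg m h) '' ↑H) (ltIdeal m I)

/-- `m` is the degree reverse lexicographic order (with the reversed conventions of the
paper: for equal degrees, `μ ≺ ν` iff the first nonvanishing entry of `μ - ν` is positive). -/
def IsRevLex {n : ℕ} (m : MonomialOrder (Fin n)) : Prop :=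
  ∀ μ ν : Fin n →₀ ℕ, m.toSyn μ < m.toSyn ν ↔
    ((μ.sum fun _ e => e) < (ν.sum fun _ e => e) ∨
      ((μ.sum fun _ e => e) = (ν.sum fun _ e => e) ∧
        ∃ i : Fin n, ν i < μ i ∧ ∀ j : Fin n, j < i → μ j = ν j))

/-- `I` is a homogeneous ideal. -/
def IsHomIdeal {n : ℕ} {K : Type*} [Field K] (I : Ideal (MvPolynomial (Fin n) K)) : Prop :=
  ∃ S : Set (MvPolynomial (Fin n) K), (∀ f ∈ S, ∃ d, f.IsHomogeneous d) ∧ I = Ideal.span S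

lemma ldeg_eq {n : ℕ} {K : Type*} [Field K] (m : MonomialOrder (Fin n))
    (f : MvPolynomial (Fin n) K) : ldeg m f = m.degree f := rfl

lemma ltIdeal_eq {n : ℕ} {K : Type*} [Field K] (m : MonomialOrder (Fin n))
    (I : Ideal (MvPolynomial (Fin n) K)) :
    ltIdeal m I = Ideal.span ((fun μ => monomial μ (1 : K)) ''
      {μ | ∃ f ∈ I, f ≠ 0 ∧ m.degree f = μ}) := by
  unfold ltIdeal
  congr 1
  ext g
  simp only [ldeg_eq, Set.mem_ofPred_eq, Set.mem_image]
  constructor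
  · rintro ⟨f, hf, hf0, rfl⟩
    exact ⟨_, ⟨f, hf, hf0, rfl⟩, rfl⟩
  · rintro ⟨_, ⟨f, hf, hf0, rfl⟩, rfl⟩
    exact ⟨f, hf, hf0, rfl⟩

lemma mem_ltIdeal {n : ℕ} {K : Type*} [Field K] (m : MonomialOrder (Fin n))
    (I : Ideal (MvPolynomial (Fin n) K)) (x : MvPolynomial (Fin n) K) :
    x ∈ ltIdeal m I ↔ ∀ ν ∈ x.support, ∃ f ∈ I, f ≠ 0 ∧ m.degree f ≤ ν := by
  rw [ltIdeal_eq, mem_ideal_span_monomial_image]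
  refine forall₂_congr fun ν _ => ?_
  simp only [Set.mem_ofPred_eq]
  constructor
  · rintro ⟨_, ⟨f, hf, hf0, rfl⟩, h⟩
    exact ⟨f, hf, hf0, h⟩
  · rintro ⟨f, hf, hf0, h⟩
    exact ⟨_, ⟨f, hf, hf0, rfl⟩, h⟩

lemma monomial_mem_ltIdeal {n : ℕ} {K : Type*} [Field K] (m : MonomialOrder (Fin n))
    (I : Ideal (MvPolynomial (Fin n) K)) (ν : Fin n →₀ ℕ) :
    monomial ν (1 : K) ∈ ltIdeal m I ↔ ∃ f ∈ I, f ≠ 0 ∧ m.degree f ≤ ν := by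
  classical
  rw [mem_ltIdeal]
  simp [support_monomial]

/-- Key combinatorial step. -/
lemma pure_power_mem {n : ℕ} {K : Type*} [Field K] (H : Set (Fin n →₀ ℕ))
    (J : Ideal (MvPolynomial (Fin n) K)) (hH : IsMonPB H J) (d : ℕ)
    (ν : Fin n →₀ ℕ) (hν : monomial ν (1 : K) ∈ J) (hνd : ∀ i : Fin n, d < (i : ℕ) → ν i = 0)
    (i : Fin n) (hi : d ≤ (i : ℕ)) :
    ∃ a : ℕ, monomial (Finsupp.single i a) (1 : K) ∈ J := by
  classical
  obtain ⟨hfin, hspan, huniq⟩ := hH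
  obtain ⟨N, hN⟩ := (hfin.image (fun μ => μ i)).bddAbove
  have hmem : monomial (ν + Finsupp.single i (N + 1)) (1 : K) ∈ J := by
    have := J.mul_mem_right (monomial (Finsupp.single i (N + 1)) (1 : K)) hν
    rwa [monomial_mul, one_mul] at this
  obtain ⟨μ, ⟨hμH, hle, hmul⟩, -⟩ := huniq _ hmem
  have hμN : μ i ≤ N := hN ⟨μ, hμH, rfl⟩
  have hicls : (i : ℕ) ≤ cls μ := hmul i (by simp; omega)
  refine ⟨μ i, ?_⟩
  have : μ = Finsupp.single i (μ i) := by
    ext j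
    rcases lt_trichotomy j i with h | h | h
    · rw [Finsupp.single_eq_of_ne h.ne]
      by_contra hne
      have : cls μ ≤ j := Nat.sInf_le ⟨j.2, hne⟩
      have : (j : ℕ) < i := h
      omega
    · subst h; simp
    · rw [Finsupp.single_eq_of_ne h.ne']
      have h1 := hle j
      have h2 : (i : ℕ) < j := h
      rw [Finsupp.add_apply, hνd j (by omega), Finsupp.single_eq_of_ne h.ne'] at h1
      omega
  rw [← this, hspan]
  exact Ideal.subset_span ⟨μ, hμH, rfl⟩

lemma ringKrullDim_eq_of_finite_injective {R S : Type*} [CommRing R] [CommRing S] (f : R →+* S)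
    (hf : f.Finite) (hinj : Function.Injective f) : ringKrullDim R = ringKrullDim S := by
  let := f.toAlgebra
  have : Module.Finite R S := hf
  have : Algebra.IsIntegral R S := inferInstance
  have : FaithfulSMul R S := (faithfulSMul_iff_algebraMap_injective R S).2 hinj
  apply le_antisymm
  · unfold ringKrullDim Order.krullDim
    refine iSup_le fun l => ?_
    obtain ⟨P, hP, hPo⟩ := Ideal.nonempty_primesOver (R := R) (S := S) l.head.asIdeal
    obtain ⟨L, hL, -, -⟩ := Ideal.exists_ltSeries_of_hasGoingUp l P
    rw [← hL]
    exact le_iSup (fun p : LTSeries (PrimeSpectrum S) => ((p.length : ℕ∞) : WithBot ℕ∞)) L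
  · refine Order.krullDim_le_of_strictMono (PrimeSpectrum.comap (algebraMap R S)) ?_
    intro p q h
    exact Ideal.IsIntegral.comap_lt_comap (R := R) (show p.asIdeal < q.asIdeal from h)

lemma finite_of_pure_powers {n : ℕ} {K : Type*} [Field K] (m : MonomialOrder (Fin n))
    (I : Ideal (MvPolynomial (Fin n) K)) (d : ℕ)
    (h : ∀ i : Fin n, d ≤ (i : ℕ) → ∃ a : ℕ,
      monomial (Finsupp.single i a) (1 : K) ∈ ltIdeal m I) :
    RingHom.Finite ((Ideal.Quotient.mk I).comp
      ((MvPolynomial.supported K {j : Fin n | (j : ℕ) < d}).val.toRingHom)) := by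
  classical
  have h' : ∀ i : Fin n, ∃ a : ℕ, d ≤ (i : ℕ) →
      ∃ f ∈ I, f ≠ 0 ∧ m.degree f ≤ Finsupp.single i a := by
    intro i
    by_cases hi : d ≤ (i : ℕ)
    · obtain ⟨a, ha⟩ := h i hi
      exact ⟨a, fun _ => (monomial_mem_ltIdeal m I _).1 ha⟩
    · exact ⟨0, fun h => absurd h hi⟩
  choose a ha using h'
  let φ := (Ideal.Quotient.mk I).comp
      ((MvPolynomial.supported K {j : Fin n | (j : ℕ) < d}).val.toRingHom)
  let : Algebra (MvPolynomial.supported K {j : Fin n | (j : ℕ) < d})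
    (MvPolynomial (Fin n) K ⧸ I) := φ.toAlgebra
  change Module.Finite (MvPolynomial.supported K {j : Fin n | (j : ℕ) < d})
    (MvPolynomial (Fin n) K ⧸ I)
  let A : Fin n →₀ ℕ := Finsupp.equivFunOnFinite.symm a
  let T : Finset (MvPolynomial (Fin n) K ⧸ I) :=
    (Finset.Iic A).image fun β => Ideal.Quotient.mk I (monomial β (1 : K))
  refine ⟨⟨T, ?_⟩⟩
  rw [eq_top_iff]
  rintro x -
  obtain ⟨f, rfl⟩ := Ideal.Quotient.mk_surjective x
  obtain ⟨g, r, hfr, -, hr⟩ := m.div_set (B := {f | f ∈ I ∧ f ≠ 0})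
    (fun b hb => (isUnit_iff_ne_zero.2 (m.leadingCoeff_ne_zero_iff.2 hb.2))) f
  have hfI : Ideal.Quotient.mk I f = Ideal.Quotient.mk I r := by
    rw [Ideal.Quotient.eq, hfr, add_sub_cancel_right, Finsupp.linearCombination_apply]
    exact I.sum_mem fun b _ => I.mul_mem_left _ b.2.1
  rw [hfI, r.as_sum, map_sum]
  refine Submodule.sum_mem _ fun ν hν => ?_
  have hsplit : ν.filter (fun j : Fin n => (j : ℕ) < d) + ν.filter (fun j : Fin n => ¬ (j : ℕ) < d) = ν :=
    Finsupp.filter_add_filter_not _ _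
  have hs : monomial (ν.filter (fun j : Fin n => (j : ℕ) < d)) (r.coeff ν) ∈
      MvPolynomial.supported K {j : Fin n | (j : ℕ) < d} := by
    rw [mem_supported]
    intro j hj
    obtain ⟨μ, hμ, hjμ⟩ := (mem_vars_iff_mem_support j).1 hj
    have hμ' := Finset.mem_singleton.1 (support_monomial_subset hμ)
    rw [hμ', Finsupp.support_filter, Finset.mem_filter] at hjμ
    exact hjμ.2
  have key : Ideal.Quotient.mk I (monomial ν (r.coeff ν)) =
      (⟨_, hs⟩ : MvPolynomial.supported K {j : Fin n | (j : ℕ) < d}) •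
        Ideal.Quotient.mk I (monomial (ν.filter (fun j : Fin n => ¬ (j : ℕ) < d)) (1 : K)) := by
    change _ = Ideal.Quotient.mk I (monomial (ν.filter (fun j : Fin n => (j : ℕ) < d)) (r.coeff ν) *
      monomial (ν.filter (fun j : Fin n => ¬ (j : ℕ) < d)) (1 : K))
    rw [monomial_mul, hsplit, mul_one]
  rw [key]
  refine Submodule.smul_mem _ _ (Submodule.subset_span ?_)
  simp only [T, Finset.coe_image]
  refine ⟨_, ?_, rfl⟩
  simp only [Finset.coe_Iic, Set.mem_Iic]
  intro j
  by_cases hj : (j : ℕ) < d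
  · rw [Finsupp.filter_apply_neg _ _ (by simpa using hj)]
    exact Nat.zero_le _
  · rw [Finsupp.filter_apply_pos (fun j : Fin n => ¬ (j : ℕ) < d) _ hj]
    change ν j ≤ a j
    by_contra hlt
    obtain ⟨b, hbI, hb0, hble⟩ := ha j (by omega)
    refine hr ν hν b ⟨hbI, hb0⟩ (hble.trans ?_)
    rw [Finsupp.single_le_iff]
    omega

lemma supported_zero_of_not {n : ℕ} {K : Type*} [Field K] (m : MonomialOrder (Fin n))
    (I : Ideal (MvPolynomial (Fin n) K)) (d : ℕ)
    (h : ¬ ∃ ν : Fin n →₀ ℕ, monomial ν (1 : K) ∈ ltIdeal m I ∧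
      ∀ i : Fin n, d ≤ (i : ℕ) → ν i = 0) :
    (∀ f ∈ ltIdeal m I,
        f ∈ MvPolynomial.supported K {j : Fin n | (j : ℕ) < d} → f = 0) ∧
    Function.Injective ((Ideal.Quotient.mk I).comp
      ((MvPolynomial.supported K {j : Fin n | (j : ℕ) < d}).val.toRingHom)) := by
  classical
  have hsup : ∀ f ∈ MvPolynomial.supported K {j : Fin n | (j : ℕ) < d}, ∀ ν ∈ f.support,
      ∀ i : Fin n, d ≤ (i : ℕ) → ν i = 0 := by
    intro f hf ν hν i hi
    rw [mem_supported] at hf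
    by_contra hne
    have : i ∈ f.vars := (mem_vars_iff_mem_support i).2 ⟨ν, hν, by simpa using hne⟩
    have : (i : ℕ) < d := hf this
    omega
  constructor
  · intro f hf hfs
    by_contra hf0
    obtain ⟨ν, hν⟩ := support_nonempty.2 hf0
    exact h ⟨ν, (monomial_mem_ltIdeal m I ν).2 ((mem_ltIdeal m I f).1 hf ν hν),
      hsup f hfs ν hν⟩
  · rw [injective_iff_map_eq_zero]
    rintro ⟨f, hfs⟩ hf
    have hfI : f ∈ I := Ideal.Quotient.eq_zero_iff_mem.1 hf
    by_contra hf0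
    have hf0' : f ≠ 0 := fun h => hf0 (Subtype.ext h)
    exact h ⟨m.degree f, (monomial_mem_ltIdeal m I _).2 ⟨f, hfI, hf0', le_rfl⟩,
      hsup f hfs _ ((m.degree_mem_support_iff f).2 hf0')⟩

lemma ringKrullDim_supported {n : ℕ} {K : Type*} [Field K] (d : ℕ) (hd : d ≤ n) :
    ringKrullDim (MvPolynomial.supported K {j : Fin n | (j : ℕ) < d}) = d := by
  rw [ringKrullDim_eq_of_ringEquiv (supportedEquivMvPolynomial _).toRingEquiv,
    MvPolynomial.ringKrullDim_of_isNoetherianRing, ringKrullDim_eq_zero_of_field, zero_add]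
  have : Nat.card {j : Fin n | (j : ℕ) < d} = d := by
    exact (Nat.card_congr (Fin.castLEquiv hd).symm).trans (by simp)
  rw [this]

theorem statement2 {n : ℕ} {K : Type*} [Field K] (m : MonomialOrder (Fin n))
    (I : Ideal (MvPolynomial (Fin n) K)) (hI0 : I ≠ ⊥) (hIT : I ≠ ⊤) (hIhom : IsHomIdeal I)
    (H : Finset (MvPolynomial (Fin n) K)) (hPB : IsPB m H I)
    (D : ℕ) (hD : ringKrullDim (MvPolynomial (Fin n) K ⧸ I) = (D : WithBot (WithTop ℕ))) :
    (∀ f ∈ ltIdeal m I,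
        f ∈ MvPolynomial.supported K {j : Fin n | (j : ℕ) < D} → f = 0) ∧
    Function.Injective ((Ideal.Quotient.mk I).comp
      ((MvPolynomial.supported K {j : Fin n | (j : ℕ) < D}).val.toRingHom)) ∧
    RingHom.Finite ((Ideal.Quotient.mk I).comp
      ((MvPolynomial.supported K {j : Fin n | (j : ℕ) < D}).val.toRingHom)) := by
  classical
  have hmon := hPB.2.2.2
  let Q : ℕ → Prop := fun d => ∃ ν : Fin n →₀ ℕ, monomial ν (1 : K) ∈ ltIdeal m I ∧
      ∀ i : Fin n, d ≤ (i : ℕ) → ν i = 0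
  have hQn : Q n := by
    obtain ⟨f, hf, hf0⟩ := Submodule.exists_mem_ne_zero_of_ne_bot hI0
    exact ⟨m.degree f, (monomial_mem_ltIdeal m I _).2 ⟨f, hf, hf0, le_rfl⟩,
      fun i hi => absurd i.2 (by omega)⟩
  have hQ0 : ¬ Q 0 := by
    rintro ⟨ν, hν, h0⟩
    obtain ⟨f, hf, hf0, hle⟩ := (monomial_mem_ltIdeal m I _).1 hν
    have hν0 : ν = 0 := by ext i; exact h0 i (Nat.zero_le _)
    have hdeg : m.degree f = 0 := by
      rw [hν0] at hle
      exact le_antisymm hle zero_le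
    have hC := m.eq_C_of_degree_eq_zero hdeg
    apply hIT
    refine Ideal.eq_top_of_isUnit_mem I hf ?_
    rw [hC]
    exact (isUnit_iff_ne_zero.2 (m.leadingCoeff_ne_zero_iff.2 hf0)).map C
  have hex : ∃ j, Q j := ⟨n, hQn⟩
  obtain ⟨d, hd⟩ : ∃ d, Nat.find hex = d + 1 := by
    refine Nat.exists_eq_succ_of_ne_zero fun h => hQ0 ?_
    rw [← h]
    exact Nat.find_spec hex
  have hdn : d + 1 ≤ n := by rw [← hd]; exact Nat.find_min' hex hQn
  have hnot : ¬ Q d := Nat.find_min hex (by omega)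
  obtain ⟨ν, hν, hνd⟩ : Q (d + 1) := by rw [← hd]; exact Nat.find_spec hex
  have hfin := finite_of_pure_powers m I d fun i hi =>
    pure_power_mem _ _ hmon d ν hν (fun i hi => hνd i hi) i hi
  obtain ⟨h1, h2⟩ := supported_zero_of_not m I d hnot
  have hdim := ringKrullDim_eq_of_finite_injective _ hfin h2
  rw [ringKrullDim_supported d (by omega), hD] at hdim
  have hdD : d = D := by
    have h' : ((D : ℕ∞) : WithBot ℕ∞) = ((d : ℕ∞) : WithBot ℕ∞) := hdim.symm
    have h'' := WithBot.coe_injective h'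
    exact (Nat.cast_injective h'').symm
  subst hdD
  exact ⟨h1, h2, hfin⟩
end

section
/- Let H be a Pommaret basis of the proper nonzero homogeneous ideal I of P for the reverse lexicographic order and let H_1 = {h ∈ H : cls(lt(h)) = 1} be the subset of generators of class 1. If H_1 ≠ ∅, then the satiety of I equals the maximal degree of an element of H_1: sat(I) = deg(H_1). -/
open MvPolynomial

/-- The homogeneous maximal ideal `⟨x_1, …, x_n⟩`. -/
noncomputable def mxI (n : ℕ) (K : Type*) [Field K] : Ideal (MvPolynomial (Fin n) K) :=
  Ideal.span (Set.range X)

/-- The saturation `I : ⟨x_1,…,x_n⟩^∞` of `I`, as a set. -/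
def satSet {n : ℕ} {K : Type*} [Field K] (I : Ideal (MvPolynomial (Fin n) K)) :
    Set (MvPolynomial (Fin n) K) :=
  {f | ∃ s : ℕ, ∀ g ∈ (mxI n K ^ s : Ideal (MvPolynomial (Fin n) K)), g * f ∈ I}

lemma aux_cls_zero {n : ℕ} {μ : Fin n →₀ ℕ} (hμ : μ ≠ 0) (i0 : Fin n) (hi0 : (i0 : ℕ) = 0) :
    cls μ = 0 ↔ μ i0 ≠ 0 := by
  have e : i0 = ⟨0, by have := i0.2; omega⟩ := Fin.ext hi0
  unfold cls
  rw [Nat.sInf_eq_zero]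
  constructor
  · rintro (⟨h, h'⟩ | h)
    · rw [e]; exact h'
    · exfalso
      apply hμ
      ext j
      by_contra hj
      have : (j : ℕ) ∈ {i : ℕ | ∃ hi : i < n, μ ⟨i, hi⟩ ≠ 0} := ⟨j.2, hj⟩
      rw [h] at this
      exact this
  · intro h
    left
    rw [e] at h
    exact ⟨_, h⟩

lemma aux_homcomp {n : ℕ} {K : Type*} [Field K] {I : Ideal (MvPolynomial (Fin n) K)}
    (hI : IsHomIdeal I) {g : MvPolynomial (Fin n) K} (hg : g ∈ I) (p : ℕ) :
    homogeneousComponent p g ∈ I := by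
  classical
  letI : GradedAlgebra (homogeneousSubmodule (Fin n) K) := MvPolynomial.gradedAlgebra
  obtain ⟨S, hS, rfl⟩ := hI
  have := Ideal.homogeneous_span (homogeneousSubmodule (Fin n) K) S (fun x hx => by
    obtain ⟨d, hd⟩ := hS x hx
    exact ⟨d, hd⟩)
  have h2 := this p hg
  rw [← MvPolynomial.decomposition.decompose'_apply]
  exact h2

lemma aux_lt {n : ℕ} {K : Type*} [Field K] (m : MonomialOrder (Fin n))
    (I : Ideal (MvPolynomial (Fin n) K)) (ν : Fin n →₀ ℕ) :
    monomial ν (1 : K) ∈ ltIdeal m I ↔ ∃ g ∈ I, g ≠ 0 ∧ m.degree g = ν := by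
  classical
  constructor
  · intro h
    have e : {g | ∃ f ∈ I, f ≠ 0 ∧ g = monomial (ldeg m f) (1 : K)} =
        (fun s => monomial s (1 : K)) '' {s | ∃ f ∈ I, f ≠ 0 ∧ ldeg m f = s} := by
      ext g
      constructor
      · rintro ⟨f, hf, h0, rfl⟩
        exact ⟨_, ⟨f, hf, h0, rfl⟩, rfl⟩
      · rintro ⟨_, ⟨f, hf, h0, rfl⟩, rfl⟩
        exact ⟨f, hf, h0, rfl⟩
    unfold ltIdeal at h
    rw [e, mem_ideal_span_monomial_image] at h
    obtain ⟨_, ⟨f, hf, h0, rfl⟩, hle⟩ := h ν (by simp [mem_support_iff])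
    have hm : monomial (ν - ldeg m f) (1 : K) ≠ 0 := by simp
    refine ⟨monomial (ν - ldeg m f) 1 * f, I.mul_mem_left _ hf, mul_ne_zero hm h0, ?_⟩
    rw [m.degree_mul hm h0, m.degree_monomial, if_neg one_ne_zero]
    exact tsub_add_cancel_of_le hle
  · rintro ⟨g, hg, h0, rfl⟩
    exact Ideal.subset_span ⟨g, hg, h0, rfl⟩

lemma aux_deg_le {n : ℕ} {m : MonomialOrder (Fin n)} (hrev : IsRevLex m)
    {μ ν : Fin n →₀ ℕ} (h : m.toSyn μ ≤ m.toSyn ν) : μ.degree ≤ ν.degree := by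
  by_contra hc
  push Not at hc
  exact absurd h (not_le.mpr ((hrev ν μ).2 (Or.inl hc)))

lemma aux_totalDegree {n : ℕ} {K : Type*} [Field K] {m : MonomialOrder (Fin n)}
    (hrev : IsRevLex m) {h : MvPolynomial (Fin n) K} (h0 : h ≠ 0) :
    h.totalDegree = (m.degree h).degree := by
  apply le_antisymm
  · rw [totalDegree]
    apply Finset.sup_le
    intro ν hν
    exact aux_deg_le hrev (m.le_degree hν)
  · exact le_totalDegree (m.degree_mem_support h0)

/-- homogeneous component of leading degree keeps the leading exponent -/
lemma aux_comp {n : ℕ} {K : Type*} [Field K] (m : MonomialOrder (Fin n))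
    {g : MvPolynomial (Fin n) K} (h0 : g ≠ 0) :
    homogeneousComponent (m.degree g).degree g ≠ 0 ∧
      m.degree (homogeneousComponent (m.degree g).degree g) = m.degree g := by
  have hs : m.degree g ∈ (homogeneousComponent (m.degree g).degree g).support := by
    rw [mem_support_iff, coeff_homogeneousComponent, if_pos rfl]
    exact m.coeff_degree_ne_zero_iff.2 h0
  have hne : homogeneousComponent (m.degree g).degree g ≠ 0 := by
    intro h; rw [h] at hs; simp at hs
  refine ⟨hne, ?_⟩
  apply m.toSyn.injective
  apply le_antisymm
  · have := m.degree_mem_support hne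
    rw [mem_support_iff, coeff_homogeneousComponent] at this
    apply m.le_degree
    rw [mem_support_iff]
    intro h
    rw [h] at this
    simp at this
  · exact m.le_degree hs

lemma aux_key {n : ℕ} {K : Type*} [Field K] (m : MonomialOrder (Fin n))
    (hrev : IsRevLex m)
    (I : Ideal (MvPolynomial (Fin n) K)) (hIhom : IsHomIdeal I)
    (H : Finset (MvPolynomial (Fin n) K)) (hPB : IsPB m H I) (hne : ∀ h ∈ H, ldeg m h ≠ 0)
    (i0 : Fin n) (hi0 : (i0 : ℕ) = 0) (Dg : ℕ)
    (hDg : ∀ h ∈ H, cls (ldeg m h) = 0 → h.totalDegree ≤ Dg) (p : ℕ) (hp : Dg ≤ p) (s : ℕ) :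
    ∀ (a : m.syn) (f : MvPolynomial (Fin n) K), m.toSyn (m.degree f) = a → f.IsHomogeneous p →
      X i0 ^ s * f ∈ I → f ∈ I := by
  classical
  intro a
  induction a using WellFoundedLT.induction with
  | ind a ih =>
  intro f hfa hf hx
  by_cases h0 : f = 0
  · rw [h0]; exact I.zero_mem
  have hXs : (X i0 ^ s : MvPolynomial (Fin n) K) ≠ 0 := pow_ne_zero _ (X_ne_zero _)
  have hdeg : m.degree (X i0 ^ s * f) = Finsupp.single i0 s + m.degree f := by
    rw [m.degree_mul hXs h0, X_pow_eq_monomial, m.degree_monomial, if_neg one_ne_zero]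
  have hfd : (m.degree f).degree = p := by
    have := hf (m.coeff_degree_ne_zero_iff.2 h0)
    rwa [Finsupp.degree_eq_weight_one]
  obtain ⟨hHI, hH0, hinj, hfin, hspan, huniq⟩ := hPB
  have hmem : monomial (Finsupp.single i0 s + m.degree f) (1 : K) ∈ ltIdeal m I :=
    (aux_lt m I _).2 ⟨_, hx, mul_ne_zero hXs h0, hdeg⟩
  obtain ⟨μ, ⟨⟨h, hhH, rfl⟩, hle, hdiv⟩, -⟩ := huniq _ hmem
  simp only at hle hdiv
  have hle' : ldeg m h ≤ m.degree f := by
    by_cases hc : cls (ldeg m h) = 0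
    · have hd := hDg h hhH hc
      rw [aux_totalDegree hrev (hH0 h hhH)] at hd
      have hd' : (ldeg m h).degree ≤ p := le_trans hd hp
      have hoff : ∀ j, j ≠ i0 → m.degree f j = ldeg m h j := by
        intro j hj
        by_contra hcon
        have := hdiv j (by
          rw [Finsupp.add_apply, Finsupp.single_eq_of_ne hj, zero_add]; exact hcon)
        apply hj
        apply Fin.ext
        omega
      intro j
      by_cases hj : j = i0
      · subst hj
        rw [← hfd] at hd'
        rw [Finsupp.degree_eq_sum, Finsupp.degree_eq_sum,
          ← Finset.add_sum_erase _ _ (Finset.mem_univ j),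
          ← Finset.add_sum_erase _ _ (Finset.mem_univ j)] at hd'
        have : ∑ x ∈ Finset.univ.erase j, ldeg m h x
            = ∑ x ∈ Finset.univ.erase j, m.degree f x :=
          Finset.sum_congr rfl fun x hx => (hoff x (Finset.ne_of_mem_erase hx)).symm
        omega
      · exact (hoff j hj).ge
    · rw [aux_cls_zero (hne h hhH) i0 hi0] at hc
      push Not at hc
      intro j
      by_cases hj : j = i0
      · subst hj; rw [hc]; exact Nat.zero_le _
      · have := hle j
        rwa [Finsupp.add_apply, Finsupp.single_eq_of_ne hj, zero_add] at this
  -- reduce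
  have hm : monomial (m.degree f - ldeg m h) (1 : K) ≠ 0 := by simp
  have hg0 := mul_ne_zero hm (hH0 h hhH)
  have hgd : m.degree (monomial (m.degree f - ldeg m h) (1 : K) * h) = m.degree f := by
    rw [m.degree_mul hm (hH0 h hhH), m.degree_monomial, if_neg one_ne_zero]
    exact tsub_add_cancel_of_le hle'
  have hgI : monomial (m.degree f - ldeg m h) (1 : K) * h ∈ I := I.mul_mem_left _ (hHI h hhH)
  obtain ⟨hg0', hgd'⟩ := aux_comp m hg0
  have hgI' := aux_homcomp hIhom hgI p
  have hghom := homogeneousComponent_isHomogeneous p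
    (monomial (m.degree f - ldeg m h) (1 : K) * h)
  rw [hgd, hfd] at hg0' hgd'
  generalize homogeneousComponent p (monomial (m.degree f - ldeg m h) (1 : K) * h) = g at *
  set c := f.coeff (m.degree f) / g.coeff (m.degree f) with hc
  have hgc : g.coeff (m.degree f) ≠ 0 := by
    rw [← hgd']; exact m.coeff_degree_ne_zero_iff.2 hg0'
  have hcg : C c * g ∈ I := I.mul_mem_left _ hgI'
  have hcghom : (C c * g).IsHomogeneous p := by
    have := (isHomogeneous_C (Fin n) c).mul hghom
    rwa [zero_add] at this
  suffices hs : f - C c * g ∈ I by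
    have := I.add_mem hs hcg
    rwa [sub_add_cancel] at this
  by_cases hr0 : f - C c * g = 0
  · rw [hr0]; exact I.zero_mem
  refine ih _ ?_ _ rfl (hf.sub hcghom) ?_
  · rw [← hfa]
    have hsup := m.degree_mem_support hr0
    rw [mem_support_iff, coeff_sub, coeff_C_mul] at hsup
    apply lt_of_le_of_ne
    · by_contra hcon
      push Not at hcon
      apply hsup
      rw [m.coeff_eq_zero_of_lt hcon, m.coeff_eq_zero_of_lt (by rw [hgd']; exact hcon)]
      simp
    · intro heq
      rw [m.toSyn.injective heq] at hsup
      apply hsup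
      rw [hc]
      field_simp
      simp
  · rw [mul_sub]
    exact I.sub_mem hx (I.mul_mem_left _ hcg)

/-- Thm. 2.6 (iv): for a Pommaret basis `H` of `I` w.r.t. revlex with
`H_1 ≠ ∅`, the satiety of `I` is the maximal degree of an element of `H_1`
(class 1 is class 0 in our 0-based indexing). -/
theorem statement6 {n : ℕ} {K : Type*} [Field K] (m : MonomialOrder (Fin n))
    (hrev : IsRevLex m)
    (I : Ideal (MvPolynomial (Fin n) K)) (hI0 : I ≠ ⊥) (hIT : I ≠ ⊤) (hIhom : IsHomIdeal I)
    (H : Finset (MvPolynomial (Fin n) K)) (hPB : IsPB m H I)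
    (Dg : ℕ)
    (hDg : IsGreatest {d : ℕ | ∃ h ∈ H, cls (ldeg m h) = 0 ∧ h.totalDegree = d} Dg) :
    IsLeast {q : ℕ | ∀ p : ℕ, q ≤ p → ∀ f : MvPolynomial (Fin n) K,
      f.IsHomogeneous p → (f ∈ satSet I ↔ f ∈ I)} Dg := by
  classical
  have hPB' := hPB
  obtain ⟨hHI, hH0, hinj, hfin, hspan, huniq⟩ := hPB'
  have hne : ∀ h ∈ H, ldeg m h ≠ 0 := by
    intro h hh h0
    apply hIT
    have ht : h.totalDegree = 0 := by
      rw [aux_totalDegree hrev (hH0 h hh)]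
      change (ldeg m h).degree = 0
      rw [h0]; simp
    rw [totalDegree_eq_zero_iff_eq_C] at ht
    have hc : h.coeff 0 ≠ 0 := by
      intro hc
      rw [hc, C_0] at ht
      exact hH0 h hh ht
    apply Ideal.eq_top_of_isUnit_mem _ (hHI h hh)
    rw [ht]
    exact (isUnit_iff_ne_zero.2 hc).map C
  obtain ⟨⟨h, hhH, hcls, htd⟩, hub⟩ := hDg
  obtain ⟨i0, hi0⟩ : ∃ i : Fin n, (i : ℕ) = 0 := by
    obtain ⟨i, -⟩ := Finsupp.ne_iff.1 (hne h hhH)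
    exact ⟨⟨0, by have := i.2; omega⟩, rfl⟩
  have hub' : ∀ h ∈ H, cls (ldeg m h) = 0 → h.totalDegree ≤ Dg :=
    fun h hh hc => hub ⟨h, hh, hc, rfl⟩
  have key := fun p hp s f => aux_key m hrev I hIhom H hPB hne i0 hi0 Dg hub' p hp s _ f rfl
  refine ⟨?_, ?_⟩
  · intro p hp f hf
    constructor
    · rintro ⟨s, hs⟩
      exact key p hp s f hf (hs _ (Ideal.pow_mem_pow (Ideal.subset_span (Set.mem_range_self i0)) s))
    · intro hfI
      exact ⟨0, fun g _ => I.mul_mem_left _ hfI⟩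
  · intro q hq
    by_contra hlt
    push Not at hlt
    have hh0 := hH0 h hhH
    have hD : (m.degree h).degree = Dg := by rw [← aux_totalDegree hrev hh0, htd]
    obtain ⟨hk0, hkd⟩ := aux_comp m hh0
    have hkI := aux_homcomp hIhom (hHI h hhH) Dg
    have hkhom := homogeneousComponent_isHomogeneous Dg h
    rw [hD] at hk0 hkd
    generalize homogeneousComponent Dg h = k at *
    have hμ0 : m.degree h i0 ≠ 0 := (aux_cls_zero (hne h hhH) i0 hi0).1 hcls
    have hdvd : X i0 ∣ k := by
      rw [k.as_sum]
      apply Finset.dvd_sum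
      intro ν hν
      rw [X_dvd_monomial]
      right
      intro hν0
      have hle := m.le_degree hν
      rw [hkd] at hle
      have hνd : ν.degree = Dg := by
        have := hkhom (mem_support_iff.1 hν)
        rwa [Finsupp.degree_eq_weight_one]
      refine absurd hle (not_le.2 ((hrev _ _).2 (Or.inr ⟨?_, i0, ?_, ?_⟩)))
      · exact hD.trans hνd.symm
      · omega
      · intro j hj
        have : (j : ℕ) < i0 := hj
        omega
    obtain ⟨g, rfl⟩ := hdvd
    have hg0 : g ≠ 0 := right_ne_zero_of_mul hk0
    have hghom : g.IsHomogeneous (Dg - 1) := by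
      intro d hd
      have h1 := hkhom (d := Finsupp.single i0 1 + d) (by rwa [coeff_X_mul])
      rw [map_add, Finsupp.weight_single] at h1
      simp at h1
      omega
    rw [m.degree_mul (X_ne_zero _) hg0, m.degree_X] at hkd
    have hDpos : Dg ≠ 0 := by
      rw [← hD, ← hkd, map_add]
      simp
    have hgI : g ∈ I := by
      refine (hq (Dg - 1) (by omega) g hghom).1 ⟨1, ?_⟩
      intro a ha
      rw [pow_one] at ha
      unfold mxI at ha
      induction ha using Submodule.span_induction with
      | mem x hx =>
        obtain ⟨j, rfl⟩ := hx
        refine key Dg le_rfl 1 _ ?_ ?_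
        · have := (isHomogeneous_X K j).mul hghom
          rwa [show 1 + (Dg - 1) = Dg by omega] at this
        · rw [pow_one, mul_left_comm]
          exact I.mul_mem_left _ hkI
      | zero => simp
      | add x y _ _ hx hy => rw [add_mul]; exact I.add_mem hx hy
      | smul a x _ hx => rw [smul_eq_mul, mul_assoc]; exact I.mul_mem_left _ hx
    obtain ⟨μ, ⟨hμH, hμle, hμdiv⟩, -⟩ := huniq _ ((aux_lt m I _).2 ⟨g, hgI, hg0, rfl⟩)
    have huq := huniq _ ((aux_lt m I _).2 ⟨h, hHI h hhH, hh0, rfl⟩)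
    have e : μ = m.degree h := by
      refine huq.unique ⟨hμH, ?_, ?_⟩ ⟨⟨h, hhH, rfl⟩, le_rfl, fun j hj => absurd rfl hj⟩
      · rw [← hkd]
        exact hμle.trans (le_add_of_nonneg_left (zero_le))
      · intro j hj
        by_cases hj0 : j = i0
        · subst hj0; omega
        · apply hμdiv j
          rwa [← hkd, Finsupp.add_apply, Finsupp.single_eq_of_ne hj0, zero_add] at hj
    have h1 := hμle i0
    rw [e, ← hkd] at h1
    simp at h1
end
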